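/- Each of the frame properties (r), (i), (c), (d), (t), (b), (s), (4), and (5) is undefinable in the language L(∇,•): for each such property P there is no set Γ of L(∇,•)-formulas such that, for every neighborhood frame F, F satisfies P if and only if every formula of Γ is valid on F. -/

import Mathlib

/-- The language L(∇,•) over propositional variables indexed by ℕ. -/
inductive Formula : Type
  | atom : ℕ → Formula
  | neg : Formula → Formula
  | and : Formula → Formula → Formula
  | nabla : Formula → Formula
  | bullet : Formula → Formula

namespace Formula

/-- Disjunction, defined from ¬ and ∧ as usual. -/
def or (φ ψ : Formula) : Formula := neg ((neg φ).and (neg ψ))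

/-- Implication, defined from ¬ and ∧ as usual. -/
def imp (φ ψ : Formula) : Formula := (neg φ).or ψ

/-- Biimplication, defined from ¬ and ∧ as usual. -/
def biimp (φ ψ : Formula) : Formula := (φ.imp ψ).and (ψ.imp φ)

/-- A fixed tautology ⊤. -/
def top : Formula := (atom 0).imp (atom 0)

/-- Δφ := ¬∇φ. -/
def delta (φ : Formula) : Formula := neg (nabla φ)

/-- ∘φ := ¬•φ. -/
def circ (φ : Formula) : Formula := neg (bullet φ)

end Formula

/-- A neighborhood model. -/
structure NbhdModel : Type 1 where
  S : Type
  ne : Nonempty S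
  N : S → Set (Set S)
  V : ℕ → Set S

namespace NbhdModel

/-- The truth set ⟦φ⟧_M of a formula in a neighborhood model. -/
def truthSet (M : NbhdModel) : Formula → Set M.S
  | .atom p => M.V p
  | .neg φ => (M.truthSet φ)ᶜ
  | .and φ ψ => M.truthSet φ ∩ M.truthSet ψ
  | .nabla φ => {s | M.truthSet φ ∉ M.N s ∧ (M.truthSet φ)ᶜ ∉ M.N s}
  | .bullet φ => {s | s ∈ M.truthSet φ ∧ M.truthSet φ ∉ M.N s}

/-- M,s ⊨ φ. -/
def Sat (M : NbhdModel) (s : M.S) (φ : Formula) : Prop := s ∈ M.truthSet φ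

/-- Property (n): N(s) contains the unit. -/
def PropN (M : NbhdModel) : Prop := ∀ s : M.S, (Set.univ : Set M.S) ∈ M.N s

/-- Property (r): N(s) contains its core. -/
def PropR (M : NbhdModel) : Prop := ∀ s : M.S, ⋂₀ (M.N s) ∈ M.N s

/-- Property (i): N(s) is closed under binary intersections. -/
def PropI (M : NbhdModel) : Prop :=
  ∀ (s : M.S) (X Y : Set M.S), X ∈ M.N s → Y ∈ M.N s → X ∩ Y ∈ M.N s

/-- Property (s): N(s) is supplemented (closed under supersets). -/
def PropS (M : NbhdModel) : Prop :=
  ∀ (s : M.S) (X Y : Set M.S), X ∈ M.N s → X ⊆ Y → Y ∈ M.N s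

/-- Property (c): N(s) is closed under complements. -/
def PropC (M : NbhdModel) : Prop :=
  ∀ (s : M.S) (X : Set M.S), X ∈ M.N s → Xᶜ ∈ M.N s

/-- Property (d). -/
def PropD (M : NbhdModel) : Prop :=
  ∀ (s : M.S) (X : Set M.S), X ∈ M.N s → Xᶜ ∉ M.N s

/-- Property (t). -/
def PropT (M : NbhdModel) : Prop :=
  ∀ (s : M.S) (X : Set M.S), X ∈ M.N s → s ∈ X

/-- Property (b). -/
def PropB (M : NbhdModel) : Prop :=
  ∀ (s : M.S) (X : Set M.S), s ∈ X → {u : M.S | Xᶜ ∉ M.N u} ∈ M.N s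

/-- Property (4). -/
def Prop4 (M : NbhdModel) : Prop :=
  ∀ (s : M.S) (X : Set M.S), X ∈ M.N s → {u : M.S | X ∈ M.N u} ∈ M.N s

/-- Property (5). -/
def Prop5 (M : NbhdModel) : Prop :=
  ∀ (s : M.S) (X : Set M.S), X ∉ M.N s → {u : M.S | X ∉ M.N u} ∈ M.N s

end NbhdModel

/-- A neighborhood frame. -/
structure NbhdFrame : Type 1 where
  S : Type
  ne : Nonempty S
  N : S → Set (Set S)

namespace NbhdFrame

/-- The model based on a frame given a valuation. -/
def toModel (F : NbhdFrame) (V : ℕ → Set F.S) : NbhdModel :=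
  { S := F.S, ne := F.ne, N := F.N, V := V }

/-- φ is valid on F: true at every state of every model based on F. -/
def Valid (F : NbhdFrame) (φ : Formula) : Prop :=
  ∀ (V : ℕ → Set F.S) (s : F.S), (F.toModel V).Sat s φ

end NbhdFrame

namespace NbhdFrame

/-- Frame property (r). -/
def PropR (F : NbhdFrame) : Prop := ∀ s : F.S, ⋂₀ (F.N s) ∈ F.N s

/-- Frame property (i). -/
def PropI (F : NbhdFrame) : Prop :=
  ∀ (s : F.S) (X Y : Set F.S), X ∈ F.N s → Y ∈ F.N s → X ∩ Y ∈ F.N s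

/-- Frame property (s). -/
def PropS (F : NbhdFrame) : Prop :=
  ∀ (s : F.S) (X Y : Set F.S), X ∈ F.N s → X ⊆ Y → Y ∈ F.N s

/-- Frame property (c). -/
def PropC (F : NbhdFrame) : Prop :=
  ∀ (s : F.S) (X : Set F.S), X ∈ F.N s → Xᶜ ∈ F.N s

/-- Frame property (d). -/
def PropD (F : NbhdFrame) : Prop :=
  ∀ (s : F.S) (X : Set F.S), X ∈ F.N s → Xᶜ ∉ F.N s

/-- Frame property (t). -/
def PropT (F : NbhdFrame) : Prop :=
  ∀ (s : F.S) (X : Set F.S), X ∈ F.N s → s ∈ X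

/-- Frame property (b). -/
def PropB (F : NbhdFrame) : Prop :=
  ∀ (s : F.S) (X : Set F.S), s ∈ X → {u : F.S | Xᶜ ∉ F.N u} ∈ F.N s

/-- Frame property (4). -/
def Prop4 (F : NbhdFrame) : Prop :=
  ∀ (s : F.S) (X : Set F.S), X ∈ F.N s → {u : F.S | X ∈ F.N u} ∈ F.N s

/-- Frame property (5). -/
def Prop5 (F : NbhdFrame) : Prop :=
  ∀ (s : F.S) (X : Set F.S), X ∉ F.N s → {u : F.S | X ∉ F.N u} ∈ F.N s

end NbhdFrame

/-- Γ defines the frame property P: for all frames F, F has P iff every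
member of Γ is valid on F. -/
def Defines (Γ : Set Formula) (P : NbhdFrame → Prop) : Prop :=
  ∀ F : NbhdFrame, P F ↔ ∀ φ ∈ Γ, F.Valid φ

/-- P is undefinable in L(∇,•): no set of formulas defines it. -/
def Undefinable (P : NbhdFrame → Prop) : Prop :=
  ¬ ∃ Γ : Set Formula, Defines Γ P

/-- Two neighborhood functions that agree on the sets containing the current state, and on the
complements of those sets that are not neighborhoods. -/
def Indistinguishable {S : Type} (N N' : S → Set (Set S)) : Prop :=
  ∀ (s : S) (X : Set S), s ∈ X →
    (X ∈ N s ↔ X ∈ N' s) ∧ (X ∉ N s → (Xᶜ ∈ N s ↔ Xᶜ ∈ N' s))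

namespace Indistinguishable

variable {S : Type} {N N' : S → Set (Set S)}

theorem truthSet_eq (h : Indistinguishable N N') (ne : Nonempty S) (V : ℕ → Set S)
    (φ : Formula) :
    NbhdModel.truthSet ⟨S, ne, N, V⟩ φ = NbhdModel.truthSet ⟨S, ne, N', V⟩ φ := by
  induction φ with
  | atom p => rfl
  | neg φ ih => simp only [NbhdModel.truthSet, ih]
  | and φ ψ ihφ ihψ => simp only [NbhdModel.truthSet, ihφ, ihψ]
  | nabla φ ih =>
    simp only [NbhdModel.truthSet, ih]
    ext s
    simp only [Set.mem_ofPred_eq]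
    generalize NbhdModel.truthSet ⟨S, ne, N', V⟩ φ = X
    by_cases hs : s ∈ X
    · have := h s X hs
      tauto
    · have := h s Xᶜ hs
      rw [compl_compl] at this
      tauto
  | bullet φ ih =>
    simp only [NbhdModel.truthSet, ih]
    ext s
    exact and_congr_right fun hs => not_congr (h s _ hs).1

theorem valid_iff (h : Indistinguishable N N') (ne : Nonempty S) (φ : Formula) :
    NbhdFrame.Valid ⟨S, ne, N⟩ φ ↔ NbhdFrame.Valid ⟨S, ne, N'⟩ φ :=
  forall_congr' fun V => forall_congr' fun s => by
    change s ∈ NbhdModel.truthSet ⟨S, ne, N, V⟩ φ ↔ s ∈ NbhdModel.truthSet ⟨S, ne, N', V⟩ φ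
    rw [h.truthSet_eq ne V φ]

theorem undefinable (h : Indistinguishable N N') (ne : Nonempty S) {P : NbhdFrame → Prop}
    (hP : P ⟨S, ne, N⟩) (hP' : ¬ P ⟨S, ne, N'⟩) : Undefinable P := by
  rintro ⟨Γ, hΓ⟩
  exact hP' ((hΓ _).2 fun φ hφ => (h.valid_iff ne φ).1 ((hΓ _).1 hP φ hφ))

theorem symm (h : Indistinguishable N N') : Indistinguishable N' N := fun s X hs =>
  ⟨(h s X hs).1.symm, fun hX => ((h s X hs).2 (mt (h s X hs).1.1 hX)).symm⟩

theorem trans {N'' : S → Set (Set S)} (h : Indistinguishable N N')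
    (h' : Indistinguishable N' N'') : Indistinguishable N N'' := fun s X hs =>
  ⟨(h s X hs).1.trans (h' s X hs).1, fun hX =>
    ((h s X hs).2 hX).trans ((h' s X hs).2 (mt (h s X hs).1.2 hX))⟩

/-- Complements of neighborhoods containing the current state can be added freely. -/
theorem of_union {A : S → Set (Set S)} (hA : ∀ s, ∀ X ∈ A s, s ∉ X ∧ Xᶜ ∈ N s) :
    Indistinguishable N (fun s => N s ∪ A s) := fun s X hs =>
  ⟨⟨Or.inl, fun hX => hX.resolve_right fun hXA => (hA s X hXA).1 hs⟩, fun hX =>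
    ⟨Or.inl, fun hXc => hXc.resolve_right fun hXA => hX (by simpa using (hA s _ hXA).2)⟩⟩

end Indistinguishable

/-- Only the unit is a neighborhood. -/
def unitNbhd (_ : Bool) : Set (Set Bool) := {Set.univ}

/-- The empty set is added to `unitNbhd` at the state `true`. -/
def unitNbhdEmptyAtTrue (s : Bool) : Set (Set Bool) := unitNbhd s ∪ {X | X = ∅ ∧ s = true}

/-- The empty set is added to `unitNbhd` at both states. -/
def unitNbhdEmpty (s : Bool) : Set (Set Bool) := unitNbhd s ∪ {∅}

/-- The supersets of the singleton of the current state. -/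
def pointNbhd (s : Bool) : Set (Set Bool) := {X | s ∈ X}

/-- The complement of the singleton of the current state is added to `pointNbhd`. -/
def pointNbhdCompl (s : Bool) : Set (Set Bool) := pointNbhd s ∪ {{s}ᶜ}

theorem indistinguishable_unitNbhdEmptyAtTrue :
    Indistinguishable unitNbhd unitNbhdEmptyAtTrue :=
  Indistinguishable.of_union (by rintro s X ⟨rfl, -⟩; simp [unitNbhd])

theorem indistinguishable_unitNbhdEmpty : Indistinguishable unitNbhd unitNbhdEmpty :=
  Indistinguishable.of_union (by rintro s X rfl; simp [unitNbhd])

theorem indistinguishable_pointNbhdCompl : Indistinguishable pointNbhd pointNbhdCompl :=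
  Indistinguishable.of_union (by rintro s X rfl; simp [pointNbhd])

theorem setOf_eq_true_ne_univ : {u : Bool | u = true} ≠ Set.univ := fun h =>
  Bool.false_ne_true (h.symm ▸ Set.mem_univ false : false ∈ {u : Bool | u = true})

theorem setOf_eq_true_ne_empty : {u : Bool | u = true} ≠ ∅ := fun h =>
  (h ▸ rfl : true ∈ (∅ : Set Bool))

theorem empty_mem_unitNbhdEmptyAtTrue_iff (u : Bool) :
    ∅ ∈ unitNbhdEmptyAtTrue u ↔ u = true := by
  simp only [unitNbhdEmptyAtTrue, unitNbhd, Set.mem_union, Set.mem_singleton_iff,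
    Set.empty_ne_univ, Set.mem_ofPred_eq, true_and, false_or]

theorem undefinable_propR : Undefinable NbhdFrame.PropR := by
  refine indistinguishable_pointNbhdCompl.undefinable ⟨true⟩ (fun s X hX => hX) fun h => ?_
  have hc : ⋂₀ pointNbhdCompl true = ∅ := Set.eq_empty_of_forall_notMem fun x hx =>
    hx {true}ᶜ (Or.inr rfl) (hx {true} (Or.inl rfl))
  have := h true
  change ⋂₀ pointNbhdCompl true ∈ pointNbhdCompl true at this
  rw [hc] at this
  rcases this with h | h
  · exact h
  · exact (h ▸ (by simp) : false ∈ (∅ : Set Bool))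

theorem undefinable_propI : Undefinable NbhdFrame.PropI := by
  refine indistinguishable_pointNbhdCompl.undefinable ⟨true⟩ (fun s X Y hX hY => ⟨hX, hY⟩)
    fun h => ?_
  have := h true {true} {true}ᶜ (Or.inl rfl) (Or.inr rfl)
  rw [Set.inter_compl_self] at this
  rcases this with h | h
  · exact h
  · exact (h ▸ (by simp) : false ∈ (∅ : Set Bool))

theorem undefinable_propC : Undefinable NbhdFrame.PropC := by
  refine indistinguishable_unitNbhdEmpty.symm.undefinable ⟨true⟩ ?_ fun h => ?_
  · rintro s X (rfl | rfl)
    · exact Or.inr Set.compl_univ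
    · exact Or.inl Set.compl_empty
  · have := h true Set.univ rfl
    rw [Set.compl_univ] at this
    exact Set.empty_ne_univ this

theorem undefinable_propD : Undefinable NbhdFrame.PropD := by
  refine indistinguishable_unitNbhdEmpty.undefinable ⟨true⟩ ?_ fun h => ?_
  · rintro s X rfl hX
    rw [Set.compl_univ] at hX
    exact Set.empty_ne_univ hX
  · exact h true Set.univ (Or.inl rfl) (Or.inr Set.compl_univ)

theorem undefinable_propT : Undefinable NbhdFrame.PropT := by
  refine indistinguishable_unitNbhdEmpty.undefinable ⟨true⟩ ?_ fun h => ?_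
  · rintro s X rfl
    trivial
  · exact h true ∅ (Or.inr rfl)

theorem undefinable_propB : Undefinable NbhdFrame.PropB := by
  refine indistinguishable_unitNbhdEmptyAtTrue.undefinable ⟨true⟩ ?_ fun h => ?_
  · refine fun s X hs => Set.eq_univ_of_forall fun u hX => ?_
    exact (Set.eq_univ_iff_forall.1 hX s : s ∈ Xᶜ) hs
  · have := h true Set.univ trivial
    simp only [Set.compl_univ, empty_mem_unitNbhdEmptyAtTrue_iff] at this
    rcases this with h | h
    · exact absurd (h.symm ▸ Set.mem_univ true : true ∈ {u : Bool | ¬ u = true}) (by simp)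
    · exact (h.1 ▸ Bool.false_ne_true : false ∈ (∅ : Set Bool))

theorem undefinable_propS : Undefinable NbhdFrame.PropS := by
  refine indistinguishable_unitNbhdEmpty.undefinable ⟨true⟩ ?_ fun h => ?_
  · rintro s X Y rfl hXY
    exact Set.univ_subset_iff.1 hXY
  · rcases h true ∅ {true} (Or.inr rfl) (Set.empty_subset _) with h | h
    · exact setOf_eq_true_ne_univ h
    · exact setOf_eq_true_ne_empty h

theorem undefinable_prop4 : Undefinable NbhdFrame.Prop4 := by
  refine indistinguishable_unitNbhdEmptyAtTrue.undefinable ⟨true⟩ ?_ fun h => ?_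
  · rintro s X hX
    exact Set.eq_univ_of_forall fun _ => hX
  · have := h true ∅ (Or.inr ⟨rfl, rfl⟩)
    simp only [empty_mem_unitNbhdEmptyAtTrue_iff] at this
    rcases this with h | h
    · exact setOf_eq_true_ne_univ h
    · exact setOf_eq_true_ne_empty h.1

theorem undefinable_prop5 : Undefinable NbhdFrame.Prop5 := by
  refine (indistinguishable_unitNbhdEmpty.symm.trans
    indistinguishable_unitNbhdEmptyAtTrue).undefinable ⟨true⟩ ?_ fun h => ?_
  · rintro s X hX
    exact Or.inl (Set.eq_univ_of_forall fun _ => hX)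
  · have := h false ∅ (by simp [empty_mem_unitNbhdEmptyAtTrue_iff])
    simp only [empty_mem_unitNbhdEmptyAtTrue_iff] at this
    rcases this with h | h
    · exact absurd (h.symm ▸ Set.mem_univ true : true ∈ {u : Bool | ¬ u = true}) (by simp)
    · exact Bool.false_ne_true h.2

/-- the frame properties (r), (i), (c), (d), (t), (b), (s),
(4), and (5) are undefinable in L(∇,•). -/
theorem frame_properties_undefinable :
    Undefinable NbhdFrame.PropR ∧
    Undefinable NbhdFrame.PropI ∧
    Undefinable NbhdFrame.PropC ∧
    Undefinable NbhdFrame.PropD ∧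
    Undefinable NbhdFrame.PropT ∧
    Undefinable NbhdFrame.PropB ∧
    Undefinable NbhdFrame.PropS ∧
    Undefinable NbhdFrame.Prop4 ∧
    Undefinable NbhdFrame.Prop5 := by
  exact ⟨undefinable_propR, undefinable_propI, undefinable_propC, undefinable_propD,
    undefinable_propT, undefinable_propB, undefinable_propS, undefinable_prop4,
    undefinable_prop5⟩
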